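/- Let H̄₀ = a[q₂(q₁² − p₁²) + 2q₁p₁p₂] + (β/2)(q₂q₃ + p₂p₃)(q₁² + p₁²), let F = 4a²(q₃² + p₃²) − aβ[q₃(q₁² − p₁²) + 2q₁p₁p₃] + (β²/16)(q₁² + p₁²)² + β²(q₂q₃ + p₂p₃)², and let H₂ = (q₁² + p₁²) + 2(q₂² + p₂²) + 2(q₃² + p₃²). Then for all real a, β, the three functions H̄₀, F, H₂ are pairwise in involution: {H̄₀, F} = {H̄₀, H₂} = {F, H₂} = 0 identically on ℝ⁶. -/

import Mathlib

/-- The Poisson bracket of two smooth functions on ℝ⁶ with coordinates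
`(q₁, q₂, q₃, p₁, p₂, p₃)`:
`{F, G} = Σ_{j=1}^{3} (∂F/∂q_j · ∂G/∂p_j − ∂F/∂p_j · ∂G/∂q_j)`. -/
noncomputable def poissonBracket (F G : ℝ → ℝ → ℝ → ℝ → ℝ → ℝ → ℝ)
    (q1 q2 q3 p1 p2 p3 : ℝ) : ℝ :=
    deriv (fun x => F x q2 q3 p1 p2 p3) q1 * deriv (fun x => G q1 q2 q3 x p2 p3) p1
  - deriv (fun x => F q1 q2 q3 x p2 p3) p1 * deriv (fun x => G x q2 q3 p1 p2 p3) q1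
  + deriv (fun x => F q1 x q3 p1 p2 p3) q2 * deriv (fun x => G q1 q2 q3 p1 x p3) p2
  - deriv (fun x => F q1 q2 q3 p1 x p3) p2 * deriv (fun x => G q1 x q3 p1 p2 p3) q2
  + deriv (fun x => F q1 q2 x p1 p2 p3) q3 * deriv (fun x => G q1 q2 q3 p1 p2 x) p3
  - deriv (fun x => F q1 q2 q3 p1 p2 x) p3 * deriv (fun x => G q1 q2 x p1 p2 p3) q3

theorem deriv_mul_left (c x : ℝ) : deriv (HMul.hMul c) x = c :=
  (hasDerivAt_const_mul c).deriv

/-- The three functions `H̄₀`, `F`, `H₂` are pairwise in involution on ℝ⁶. -/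
theorem H0_F_H2_pairwise_involution (a β : ℝ) (q1 q2 q3 p1 p2 p3 : ℝ) :
    poissonBracket
      (fun q1 q2 q3 p1 p2 p3 =>
        a * (q2 * (q1 ^ 2 - p1 ^ 2) + 2 * q1 * p1 * p2)
          + β / 2 * (q2 * q3 + p2 * p3) * (q1 ^ 2 + p1 ^ 2))
      (fun q1 q2 q3 p1 p2 p3 =>
        4 * a ^ 2 * (q3 ^ 2 + p3 ^ 2)
          - a * β * (q3 * (q1 ^ 2 - p1 ^ 2) + 2 * q1 * p1 * p3)
          + β ^ 2 / 16 * (q1 ^ 2 + p1 ^ 2) ^ 2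
          + β ^ 2 * (q2 * q3 + p2 * p3) ^ 2)
      q1 q2 q3 p1 p2 p3 = 0 ∧
    poissonBracket
      (fun q1 q2 q3 p1 p2 p3 =>
        a * (q2 * (q1 ^ 2 - p1 ^ 2) + 2 * q1 * p1 * p2)
          + β / 2 * (q2 * q3 + p2 * p3) * (q1 ^ 2 + p1 ^ 2))
      (fun q1 q2 q3 p1 p2 p3 =>
        (q1 ^ 2 + p1 ^ 2) + 2 * (q2 ^ 2 + p2 ^ 2) + 2 * (q3 ^ 2 + p3 ^ 2))
      q1 q2 q3 p1 p2 p3 = 0 ∧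
    poissonBracket
      (fun q1 q2 q3 p1 p2 p3 =>
        4 * a ^ 2 * (q3 ^ 2 + p3 ^ 2)
          - a * β * (q3 * (q1 ^ 2 - p1 ^ 2) + 2 * q1 * p1 * p3)
          + β ^ 2 / 16 * (q1 ^ 2 + p1 ^ 2) ^ 2
          + β ^ 2 * (q2 * q3 + p2 * p3) ^ 2)
      (fun q1 q2 q3 p1 p2 p3 =>
        (q1 ^ 2 + p1 ^ 2) + 2 * (q2 ^ 2 + p2 ^ 2) + 2 * (q3 ^ 2 + p3 ^ 2))
      q1 q2 q3 p1 p2 p3 = 0 := by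
  refine ⟨?_, ?_, ?_⟩ <;>
  · simp (disch := fun_prop) only [poissonBracket, deriv_fun_add, deriv_fun_sub, deriv_fun_mul,
      deriv_fun_pow, deriv_const, deriv_id'', deriv_mul_left]
    push_cast
    ring
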